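/- There exists a finite set Σ of TGDs such that for every computable function f_Σ from databases to the natural numbers there exists a database D with Σ ∈ CT_D and |chase(D,Σ)| > f_Σ(D). (In particular, no computable function of the database uniformly bounds the size of the finite chase for Σ.) -/

import Mathlib

set_option maxHeartbeats 1000000

/-! ### Basic syntax: atoms, TGDs, terms -/

/-- An atom: a predicate name together with a list of arguments. -/
structure Atom (T : Type) where
  pred : ℕ
  args : List T
deriving DecidableEq

def Atom.map {T U : Type} (f : T → U) (a : Atom T) : Atom U :=
  ⟨a.pred, a.args.map f⟩

/-- The signature (predicate name, arity) of an atom. -/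
def Atom.sig {T : Type} (a : Atom T) : ℕ × ℕ := (a.pred, a.args.length)

def Atom.equivProd : Atom ℕ ≃ ℕ × List ℕ where
  toFun a := (a.pred, a.args)
  invFun p := ⟨p.1, p.2⟩
  left_inv a := rfl
  right_inv p := rfl

instance : Encodable (Atom ℕ) := Encodable.ofEquiv _ Atom.equivProd

/-- A tuple-generating dependency, given by its (non-empty) body and head,
whose atoms carry variables (natural numbers) as arguments. -/
structure TGD where
  body : List (Atom ℕ)
  head : List (Atom ℕ)
  body_ne : body ≠ []
  head_ne : head ≠ []

def atomVars (a : Atom ℕ) : Finset ℕ := a.args.toFinset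

def TGD.bodyVars (σ : TGD) : Finset ℕ := σ.body.foldr (fun a s => atomVars a ∪ s) ∅
def TGD.headVars (σ : TGD) : Finset ℕ := σ.head.foldr (fun a s => atomVars a ∪ s) ∅
/-- The frontier of a TGD: variables occurring both in the body and in the head. -/
def TGD.frontier (σ : TGD) : Finset ℕ := σ.bodyVars ∩ σ.headVars
/-- The existentially quantified variables: head variables not occurring in the body. -/
def TGD.exVars (σ : TGD) : Finset ℕ := σ.headVars \ σ.bodyVars

/-- Terms: constants, and labelled nulls `⊥^z_{σ,h}` determined by a TGD `σ`,
a substitution `h` (the restriction of the trigger homomorphism to the frontier)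
and a variable `z`. -/
inductive TermT : Type where
  | const : ℕ → TermT
  | null : TGD → (ℕ → TermT) → ℕ → TermT

/-- The depth of a term. -/
def TermT.depth : TermT → ℕ
  | .const _ => 0
  | .null σ h _ => 1 + σ.frontier.sup (fun x => (h x).depth)

/-- The depth of an atom: the maximal depth of its arguments. -/
def Atom.depth (a : Atom TermT) : ℕ := (a.args.map TermT.depth).foldr max 0

/-! ### The semi-oblivious chase -/

/-- Restriction of a substitution to the frontier of a TGD (with default value elsewhere). -/
def TGD.restrict (σ : TGD) (h : ℕ → TermT) : ℕ → TermT :=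
  fun x => if x ∈ σ.frontier then h x else .const 0

/-- The map `μ` sending each frontier variable `x` to `h x` and each other (existential)
variable `z` to the null `⊥^z_{σ,h|fr(σ)}`. -/
def TGD.mu (σ : TGD) (h : ℕ → TermT) : ℕ → TermT :=
  fun x => if x ∈ σ.frontier then h x else .null σ (σ.restrict h) x

/-- The result of the trigger `(σ,h)`. -/
def TGD.result (σ : TGD) (h : ℕ → TermT) : Set (Atom TermT) :=
  {a | ∃ b ∈ σ.head, a = b.map (σ.mu h)}

abbrev Database := Finset (Atom ℕ)
abbrev Instance := Set (Atom TermT)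

def dbInstance (D : Database) : Instance := (Atom.map TermT.const) '' ↑D

/-- `chase D S` (the result of any valid semi-oblivious chase derivation of `D` w.r.t. `S`),
defined as the least set of atoms containing `D` and closed under all triggers. -/
inductive InChase (D : Database) (S : Set TGD) : Atom TermT → Prop
  | db {a : Atom ℕ} : a ∈ D → InChase D S (a.map TermT.const)
  | step {σ : TGD} (hσ : σ ∈ S) (h : ℕ → TermT)
      (hb : ∀ b ∈ σ.body, InChase D S (b.map h))
      {a : Atom TermT} (ha : a ∈ σ.result h) : InChase D S a

def chase (D : Database) (S : Set TGD) : Instance := {a | InChase D S a}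

/-- The active domain of an instance: the set of terms occurring in it. -/
def adom (I : Instance) : Set TermT := {t | ∃ a ∈ I, t ∈ a.args}

/-- `Σ ∈ CT_D`: the chase of `D` w.r.t. `Σ` is finite. -/
def InCT (D : Database) (S : Set TGD) : Prop := (chase D S).Finite

open Classical in
/-- The maximal depth of a term occurring in `chase D S`, and `⊤` if the chase is infinite. -/
noncomputable def maxdepth (D : Database) (S : Set TGD) : ℕ∞ :=
  if (chase D S).Finite then ⨆ t ∈ adom (chase D S), (TermT.depth t : ℕ∞) else ⊤

/-! ### Schema, arity, classes of TGDs -/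

def TGD.atomsList (σ : TGD) : List (Atom ℕ) := σ.body ++ σ.head

/-- The schema of a set of TGDs: the (predicate name, arity) pairs occurring in it. -/
def sch (S : Set TGD) : Set (ℕ × ℕ) := {p | ∃ σ ∈ S, ∃ a ∈ σ.atomsList, a.sig = p}

/-- The maximal arity of a predicate of the schema. -/
noncomputable def arity (S : Set TGD) : ℕ := sSup ((fun p => p.2) '' sch S)

/-- The set of atoms occurring in the TGDs of `S`. -/
def atomsOf (S : Set TGD) : Set (Atom ℕ) := {a | ∃ σ ∈ S, a ∈ σ.atomsList}

/-- `‖Σ‖ = |atoms(Σ)| · |sch(Σ)| · ar(Σ)`. -/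
noncomputable def tgdNorm (S : Set TGD) : ℕ := (atomsOf S).ncard * (sch S).ncard * arity S

/-- A TGD is guarded if some body atom contains all body variables. -/
def TGD.Guarded (σ : TGD) : Prop := ∃ a ∈ σ.body, σ.bodyVars ⊆ atomVars a

/-- A TGD is linear if its body consists of a single atom. -/
def TGD.Linear (σ : TGD) : Prop := ∃ a, σ.body = [a]

/-- A TGD is simple linear if its body is a single atom without repeated variables. -/
def TGD.SimpleLinear (σ : TGD) : Prop := ∃ a, σ.body = [a] ∧ a.args.Nodup

/-- The guard of a TGD: the leftmost body atom containing all body variables. -/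
def TGD.guard (σ : TGD) : Atom ℕ :=
  (σ.body.find? (fun a => decide (σ.bodyVars ⊆ atomVars a))).getD ⟨0, []⟩

/-! ### Chase derivations and the guarded chase forest -/

def IsTrigger (S : Set TGD) (σ : TGD) (h : ℕ → TermT) (I : Instance) : Prop :=
  σ ∈ S ∧ ∀ b ∈ σ.body, b.map h ∈ I

def IsActive (S : Set TGD) (σ : TGD) (h : ℕ → TermT) (I : Instance) : Prop :=
  IsTrigger S σ h I ∧ ¬ σ.result h ⊆ I

/-- A chase derivation of `D` w.r.t. `S`: at each step either an active trigger is applied,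
or no active trigger exists and the instance stays put (the derivation has terminated). -/
structure ChaseDerivation (D : Database) (S : Set TGD) where
  inst : ℕ → Instance
  trig : ℕ → Option (TGD × (ℕ → TermT))
  init : inst 0 = dbInstance D
  step_some : ∀ i σ h, trig i = some (σ, h) →
    IsActive S σ h (inst i) ∧ inst (i + 1) = inst i ∪ σ.result h
  step_none : ∀ i, trig i = none →
    (∀ σ h, ¬ IsActive S σ h (inst i)) ∧ inst (i + 1) = inst i

/-- The derivation is finite: it eventually reaches an instance with no active trigger. -/
def ChaseDerivation.IsFiniteDer {D : Database} {S : Set TGD} (δ : ChaseDerivation D S) : Prop :=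
  ∃ i, δ.trig i = none

/-- Fairness: every active trigger eventually becomes non-active. -/
def ChaseDerivation.Fair {D : Database} {S : Set TGD} (δ : ChaseDerivation D S) : Prop :=
  ∀ i σ h, IsActive S σ h (δ.inst i) → ∃ j, i < j ∧ ¬ IsActive S σ h (δ.inst j)

def ChaseDerivation.Valid {D : Database} {S : Set TGD} (δ : ChaseDerivation D S) : Prop :=
  δ.IsFiniteDer ∨ δ.Fair

/-- The edge relation of the guarded chase forest of a derivation. -/
def gedge {D : Database} {S : Set TGD} (δ : ChaseDerivation D S) (α β : Atom TermT) : Prop :=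
  ∃ i σ h, δ.trig i = some (σ, h) ∧ α = (TGD.guard σ).map h ∧
    β ∈ δ.inst (i + 1) \ δ.inst i

/-- The tree of the guarded chase forest rooted at the database atom `α`. -/
def gtree {D : Database} {S : Set TGD} (δ : ChaseDerivation D S) (α : Atom ℕ) : Set (Atom TermT) :=
  {β | Relation.ReflTransGen (gedge δ) (α.map TermT.const) β}

/-- The atoms of depth `i` in the tree rooted at `α`. -/
def gtreeLevel {D : Database} {S : Set TGD} (δ : ChaseDerivation D S) (α : Atom ℕ) (i : ℕ) :
    Set (Atom TermT) :=
  {β ∈ gtree δ α | Atom.depth β = i}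

/-! ### Dependency graph, reachability and non-uniform weak-acyclicity -/

/-- A position `(R, i)` of a schema: a (predicate name, arity) pair and an argument index. -/
abbrev Pos := (ℕ × ℕ) × ℕ

def occursAt {T : Type} (x : T) (a : Atom T) (p : Pos) : Prop :=
  p.1 = a.sig ∧ a.args[p.2]? = some x

/-- Normal edges of the dependency graph. -/
def NormalEdge (S : Set TGD) (p q : Pos) : Prop :=
  ∃ σ ∈ S, ∃ x ∈ σ.frontier, (∃ a ∈ σ.body, occursAt x a p) ∧ (∃ b ∈ σ.head, occursAt x b q)

/-- Special edges of the dependency graph. -/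
def SpecialEdge (S : Set TGD) (p q : Pos) : Prop :=
  ∃ σ ∈ S, ∃ x ∈ σ.frontier, (∃ a ∈ σ.body, occursAt x a p) ∧
    (∃ z ∈ σ.exVars, ∃ b ∈ σ.head, occursAt z b q)

def predEdge (S : Set TGD) (R P : ℕ × ℕ) : Prop :=
  ∃ σ ∈ S, (∃ a ∈ σ.body, a.sig = R) ∧ (∃ b ∈ σ.head, b.sig = P)

/-- `R ⤳_Σ P`: predicate reachability. -/
def Reach (S : Set TGD) : (ℕ × ℕ) → (ℕ × ℕ) → Prop := Relation.ReflTransGen (predEdge S)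

/-- `Σ` is `D`-weakly-acyclic: no `D`-supported cycle of the dependency graph
contains a special edge. -/
def DWeaklyAcyclic (D : Database) (S : Set TGD) : Prop :=
  ¬ ∃ (n : ℕ) (c : ℕ → Pos) (sp : ℕ → Bool),
      c (n + 1) = c 0 ∧
      (∀ i ≤ n, if sp i then SpecialEdge S (c i) (c (i + 1))
                else NormalEdge S (c i) (c (i + 1))) ∧
      (∃ i ≤ n, sp i = true) ∧
      (∃ i ≤ n, ∃ a ∈ D, Reach S a.sig (c i).1)

noncomputable def dSL (S : Set TGD) : ℕ := (sch S).ncard * arity S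
noncomputable def fSL (S : Set TGD) : ℕ := (dSL S + 1) * tgdNorm S ^ (2 * arity S * (dSL S + 1))
noncomputable def dL (S : Set TGD) : ℕ := (sch S).ncard * arity S ^ (arity S + 1)
noncomputable def fL (S : Set TGD) : ℕ := (dL S + 1) * tgdNorm S ^ (2 * arity S * (dL S + 1))
noncomputable def dG (S : Set TGD) : ℕ :=
  (sch S).ncard * arity S ^ (2 * arity S + 1) * 2 ^ ((sch S).ncard * arity S ^ arity S)
noncomputable def fG (S : Set TGD) : ℕ := (dG S + 1) * tgdNorm S ^ (2 * arity S * (dG S + 1))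

/-! ### Simplification -/

open Classical in
/-- `unique(t̄)`: keep only the first occurrence of each term. -/
noncomputable def uniqueList {α : Type} : List α → List α
  | [] => []
  | a :: l => a :: uniqueList (l.filter fun b => decide (b ≠ a))
termination_by l => l.length
decreasing_by
  simp only [List.length_cons, List.length_unattach]
  exact Nat.lt_succ_of_le ((List.length_filter_le _ _).trans_eq List.length_attach)

open Classical in
/-- `id(t̄)`: for each component, the position of `unique(t̄)` at which it appears. -/
noncomputable def idTuple {α : Type} (l : List α) : List ℕ :=
  l.map (fun t => (uniqueList l).idxOf t)

/-- The simplification of an atom `R(t̄)`: the atom `R_{id(t̄)}(unique(t̄))`, where the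
fresh predicate name `R_{id(t̄)}` is obtained by pairing `R` with an encoding of `id(t̄)`. -/
noncomputable def simpleAtom {α : Type} (a : Atom α) : Atom α :=
  ⟨Nat.pair a.pred (Encodable.encode (idTuple a.args)), uniqueList a.args⟩

/-- `simple(D)`. -/
noncomputable def simpleDB (D : Database) : Database := D.image simpleAtom

/-- A specialization of the tuple of variables `xs`:
`f x₁ = x₁`, `f xᵢ ∈ {f x₁, …, f xᵢ₋₁, xᵢ}`, and `f` is the identity off `xs`. -/
def IsSpecialization (xs : List ℕ) (f : ℕ → ℕ) : Prop :=
  (∀ v, v ∉ xs → f v = v) ∧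
  ∀ i : Fin xs.length, f (xs.get i) ∈ ((xs.take i).map f) ++ [xs.get i]

/-- The body atom of a (linear) TGD. -/
def TGD.bodyAtom (σ : TGD) : Atom ℕ := σ.body.head σ.body_ne

/-- The simplification of a linear TGD induced by a specialization `f`. -/
noncomputable def TGD.simplify (σ : TGD) (f : ℕ → ℕ) : TGD where
  body := [simpleAtom (σ.bodyAtom.map f)]
  head := σ.head.map (fun b => simpleAtom (b.map f))
  body_ne := by simp
  head_ne := by
    intro hcon
    exact σ.head_ne (List.map_eq_nil_iff.mp hcon)

/-- `simple(Σ)`: all simplifications of TGDs of `Σ` induced by some specialization. -/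
def simpleTGDs (S : Set TGD) : Set TGD :=
  {τ | ∃ σ ∈ S, ∃ f : ℕ → ℕ, IsSpecialization σ.bodyAtom.args f ∧ τ = σ.simplify f}

/-- Equivalence of terms up to simplification: the map
`g = {f x ↦ h x : x ∈ fr(σ)}` is a well-defined function on `fr(σ_f)` (witnessed by the
section `sec` of `f`), and `g y ≡_sim h' y` for every `y ∈ fr(σ_f)`. -/
inductive EqSim : TermT → TermT → Prop
  | const (c : ℕ) : EqSim (.const c) (.const c)
  | null (σ : TGD) (f : ℕ → ℕ) (sec : ℕ → ℕ) (h h' : ℕ → TermT) (z : ℕ)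
      (hf : IsSpecialization σ.bodyAtom.args f)
      (hfun : ∀ x ∈ σ.frontier, ∀ y ∈ σ.frontier, f x = f y → h x = h y)
      (hdom : ∀ x ∈ σ.frontier, f x ∈ (σ.simplify f).frontier)
      (hsec : ∀ y ∈ (σ.simplify f).frontier, sec y ∈ σ.frontier ∧ f (sec y) = y)
      (hrec : ∀ y ∈ (σ.simplify f).frontier, EqSim (h (sec y)) (h' y)) :
      EqSim (.null σ h z) (.null (σ.simplify f) h' z)

/-- `t̄ ≃ ū`: same length and the same equalities among components. -/
def tupleEquiv {A B : Type} (t : List A) (u : List B) : Prop :=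
  t.length = u.length ∧ ∀ i j, i < t.length → j < t.length → (t[i]? = t[j]? ↔ u[i]? = u[j]?)

/-- Equivalence of atoms up to simplification. -/
noncomputable def AtomEqSim (α β : Atom TermT) : Prop :=
  β.pred = Nat.pair α.pred (Encodable.encode (idTuple α.args)) ∧
  tupleEquiv (uniqueList α.args) β.args ∧
  List.Forall₂ EqSim (uniqueList α.args) β.args

/-! ### Linearization -/

/-- The symbolic representation of a type: a canonical guard atom over positive integers
together with a finite set of further atoms over its terms. -/
abbrev SigmaType := Atom ℕ × Finset (Atom ℕ)

/-- A canonical tuple of positive integers: `t₁ = 1` and `tᵢ ≤ max(t₁,…,tᵢ₋₁) + 1`. -/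
def IsCanonicalTuple (l : List ℕ) : Prop :=
  ∀ (i : ℕ) (h : i < l.length), 1 ≤ l[i] ∧ l[i] ≤ ((l.take i).foldr max 0) + 1

def atomsOfType (τ : SigmaType) : Finset (Atom ℕ) := insert τ.1 τ.2

def IsSigmaType (S : Set TGD) (τ : SigmaType) : Prop :=
  IsCanonicalTuple τ.1.args ∧ τ.1.sig ∈ sch S ∧
  (∀ b ∈ τ.2, b.sig ∈ sch S ∧ ∀ t ∈ b.args, t ∈ τ.1.args) ∧ τ.1 ∉ τ.2

open Classical in
noncomputable def setToFinset {α : Type} (s : Set α) : Finset α :=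
  if h : s.Finite then h.toFinset else ∅

open Classical in
/-- Canonical renaming: the `i`-th distinct value of `base` (by first occurrence)
is sent to the integer `i` (1-based). -/
noncomputable def canonInt {α : Type} (base : List α) (c : α) : ℕ :=
  (uniqueList base).idxOf c + 1

/-- The type (over the constants of `a`) of the database atom `a` w.r.t. `D` and `S`. -/
def typeOfDBAtom (D : Database) (S : Set TGD) (a : Atom ℕ) : Set (Atom ℕ) :=
  {b | (b.map TermT.const) ∈ chase D S ∧ ∀ c ∈ b.args, c ∈ a.args}

/-- The linearization of a database atom: `[τ](t̄)` where `τ` encodes the atom and its type. -/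
noncomputable def linAtom (D : Database) (S : Set TGD) (a : Atom ℕ) : Atom ℕ :=
  let ρ : ℕ → ℕ := canonInt a.args
  let g : Atom ℕ := a.map ρ
  let τ : SigmaType := (g, (setToFinset ((Atom.map ρ) '' typeOfDBAtom D S a)).erase g)
  ⟨Encodable.encode τ, a.args⟩

/-- `lin(D)`. -/
noncomputable def linDB (D : Database) (S : Set TGD) : Database := D.image (linAtom D S)

/-- `complete(I,Σ)`: the atoms of the chase of `I` whose terms all belong to `adom(I)`. -/
def completeDB (I : Database) (S : Set TGD) : Set (Atom ℕ) :=
  {a | (a.map TermT.const) ∈ chase I S ∧ ∀ c ∈ a.args, ∃ b ∈ I, c ∈ b.args}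

/-- The index (1-based) of an existential variable of a TGD. -/
noncomputable def TGD.exIndex (σ : TGD) (v : ℕ) : ℕ := (σ.exVars.sort (· ≤ ·)).idxOf v + 1

/-- The function `f` of the linearization: frontier variables are mapped by `h`, the `i`-th
existential variable to `ar(Σ) + i`. -/
noncomputable def headMap (S : Set TGD) (σ : TGD) (h : ℕ → ℕ) : ℕ → ℕ :=
  fun v => if v ∈ σ.frontier then h v else arity S + σ.exIndex v

/-- The Σ-type associated with the head atom `b` of `σ` in the linearization step. -/
noncomputable def headTypeOf (S : Set TGD) (σ : TGD) (τ : SigmaType) (h : ℕ → ℕ)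
    (b : Atom ℕ) : SigmaType :=
  let f := headMap S σ h
  let αi : Atom ℕ := b.map f
  let I : Database := (σ.head.map (Atom.map f)).toFinset ∪ atomsOfType τ
  let Ti : Set (Atom ℕ) := {β | β ∈ completeDB I S ∧ ∀ t ∈ β.args, t ∈ αi.args} \ {αi}
  let ρ : ℕ → ℕ := canonInt αi.args
  (αi.map ρ, setToFinset ((Atom.map ρ) '' Ti))

/-- The linearization of the guarded TGD `σ` induced by the Σ-type `τ` and the
homomorphism `h` from `body(σ)` to `atoms(τ)` mapping the guard to `guard(τ)`. -/
noncomputable def linTGD (S : Set TGD) (σ : TGD) (τ : SigmaType) (h : ℕ → ℕ) : TGD where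
  body := [⟨Encodable.encode τ, σ.guard.args⟩]
  head := σ.head.map (fun b => ⟨Encodable.encode (headTypeOf S σ τ h b), b.args⟩)
  body_ne := by simp
  head_ne := by
    intro hcon
    exact σ.head_ne (List.map_eq_nil_iff.mp hcon)

def IsTypeHom (S : Set TGD) (σ : TGD) (τ : SigmaType) (h : ℕ → ℕ) : Prop :=
  (∀ b ∈ σ.body, b.map h ∈ atomsOfType τ) ∧ σ.guard.map h = τ.1

/-- `lin(Σ)`. -/
def linTGDs (S : Set TGD) : Set TGD :=
  {ρ | ∃ σ ∈ S, ∃ τ : SigmaType, IsSigmaType S τ ∧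
    ∃ h : ℕ → ℕ, IsTypeHom S σ τ h ∧ ρ = linTGD S σ τ h}

/-- Equivalence of terms up to linearization. -/
inductive EqLin (S : Set TGD) : TermT → TermT → Prop
  | const (c : ℕ) : EqLin S (.const c) (.const c)
  | null (σ : TGD) (τ : SigmaType) (g : ℕ → ℕ) (h h' : ℕ → TermT) (z : ℕ)
      (hτ : IsSigmaType S τ) (hg : IsTypeHom S σ τ g)
      (hfr : ∀ y ∈ (linTGD S σ τ g).frontier, EqLin S (h y) (h' y)) :
      EqLin S (.null σ h z) (.null (linTGD S σ τ g) h' z)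

/-- The type of an atom of the chase: all chase atoms whose terms occur in it. -/
def typeOf (D : Database) (S : Set TGD) (α : Atom TermT) : Set (Atom TermT) :=
  {β ∈ chase D S | ∀ t ∈ β.args, t ∈ α.args}

/-- Equivalence of atoms up to linearization. -/
def AtomEqLin (D : Database) (S : Set TGD) (α β : Atom TermT) : Prop :=
  ∃ τ : SigmaType, β.pred = Encodable.encode τ ∧ IsSigmaType S τ ∧
    (∃ μ : TermT → ℕ,
      Set.BijOn μ (adom (typeOf D S α)) {k | ∃ a ∈ atomsOfType τ, k ∈ a.args} ∧
      (Atom.map μ) '' typeOf D S α = ↑(atomsOfType τ) ∧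
      α.map μ = τ.1) ∧
    tupleEquiv α.args β.args ∧ List.Forall₂ (EqLin S) α.args β.args

noncomputable def gsimpleDB (D : Database) (S : Set TGD) : Database := simpleDB (linDB D S)
def gsimpleTGDs (S : Set TGD) : Set TGD := simpleTGDs (linTGDs S)


namespace CB

inductive St
  | N | Z | S0 | S1 | S2 | T0 | A1 | A2 | B1 | D1 | D2 | D3 | E1 | Ret | G1 | G2 | H1 | H2 | I1 | I2
deriving DecidableEq

inductive Tag
  | zero | succ | cons | pair | khalt | kcons1 | kcons2 | kcomp | kfix
  | cz | cs | ct | ccons | ccomp | ccase | cfix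
deriving DecidableEq

instance : Fintype St := ⟨{.N, .Z, .S0, .S1, .S2, .T0, .A1, .A2, .B1, .D1, .D2, .D3, .E1, .Ret, .G1,
  .G2, .H1, .H2, .I1, .I2}, fun x => by cases x <;> decide⟩

instance : Fintype Tag := ⟨{.zero, .succ, .cons, .pair, .khalt, .kcons1, .kcons2, .kcomp, .kfix,
  .cz, .cs, .ct, .ccons, .ccomp, .ccase, .cfix}, fun x => by cases x <;> decide⟩

def St.num : St → ℕ
  | .N => 0 | .Z => 1 | .S0 => 2 | .S1 => 3 | .S2 => 4 | .T0 => 5 | .A1 => 6 | .A2 => 7 | .B1 => 8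
  | .D1 => 9 | .D2 => 10 | .D3 => 11 | .E1 => 12 | .Ret => 13 | .G1 => 14 | .G2 => 15 | .H1 => 16
  | .H2 => 17 | .I1 => 18 | .I2 => 19

def Tag.num : Tag → ℕ
  | .zero => 101 | .succ => 100 | .cons => 102 | .pair => 103 | .khalt => 104 | .kcons1 => 105
  | .kcons2 => 106 | .kcomp => 107 | .kfix => 108 | .cz => 109 | .cs => 110 | .ct => 111
  | .ccons => 112 | .ccomp => 113 | .ccase => 114 | .cfix => 115

lemma St.num_inj : ∀ a b : St, a.num = b.num → a = b := by decide
lemma Tag.num_inj : ∀ a b : Tag, a.num = b.num → a = b := by decide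

inductive Instr
  | push (g : Tag) (i j : Fin 7) (q : St) (ρ : Fin 7 → Fin 9)
  | mtch (i : Fin 7) (f : Tag → Option (St × (Fin 7 → Fin 9)))

open St in
def prog : St → Instr
  | N => .mtch 4 fun
    | .cz => some (Z, ![0,1,2,3,4,5,6])
    | .cs => some (S0, ![0,1,2,3,4,5,6])
    | .ct => some (T0, ![0,1,2,3,4,5,6])
    | .ccons => some (A1, ![0,1,2,3,7,8,6])
    | .ccomp => some (B1, ![0,1,2,3,8,7,6])
    | .ccase => some (D1, ![0,1,2,3,4,7,8])
    | .cfix => some (E1, ![0,1,2,3,7,5,6])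
    | _ => none
  | Z => .push .cons 2 1 Ret ![0,7,2,3,4,5,6]
  | S0 => .mtch 1 fun
    | .cons => some (S1, ![0,1,2,3,4,7,6])
    | _ => none
  | S1 => .push .succ 5 5 S2 ![0,1,2,3,4,7,6]
  | S2 => .push .cons 5 3 Ret ![0,7,2,3,4,5,6]
  | T0 => .mtch 1 fun
    | .cons => some (Ret, ![0,8,2,3,4,5,6])
    | _ => none
  | A1 => .push .pair 1 0 A2 ![7,1,2,3,4,5,6]
  | A2 => .push .kcons1 5 0 N ![7,1,2,3,4,5,6]
  | B1 => .push .kcomp 5 0 N ![7,1,2,3,4,5,6]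
  | D1 => .mtch 1 fun
    | .cons => some (D2, ![0,8,2,3,7,5,6])
    | _ => none
  | D2 => .mtch 4 fun
    | .zero => some (N, ![0,1,2,3,5,5,6])
    | .succ => some (D3, ![0,1,2,3,6,7,6])
    | _ => none
  | D3 => .push .cons 5 1 N ![0,7,2,3,4,5,6]
  | E1 => .push .kfix 4 0 N ![7,1,2,3,4,5,6]
  | Ret => .mtch 0 fun
    | .kcons1 => some (G1, ![0,1,2,3,7,8,6])
    | .kcons2 => some (H1, ![8,1,2,3,4,7,6])
    | .kcomp => some (N, ![8,1,2,3,7,5,6])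
    | .kfix => some (I1, ![0,1,2,3,7,5,8])
    | _ => none
  | G1 => .mtch 5 fun
    | .pair => some (G2, ![8,1,2,3,4,7,6])
    | _ => none
  | G2 => .push .kcons2 1 0 N ![7,5,2,3,4,5,6]
  | H1 => .mtch 5 fun
    | .cons => some (H2, ![0,1,2,3,4,7,6])
    | _ => none
  | H2 => .push .cons 5 1 Ret ![0,7,2,3,4,5,6]
  | I1 => .mtch 1 fun
    | .cons => some (I2, ![0,8,2,3,4,7,6])
    | _ => none
  | I2 => .mtch 5 fun
    | .zero => some (Ret, ![6,1,2,3,4,5,6])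
    | .succ => some (N, ![0,1,2,3,4,5,6])
    | _ => none

def conf {T : Type} (q : St) (r : Fin 7 → T) : Atom T := ⟨q.num, List.ofFn r⟩
def dat {T : Type} (g : Tag) (t a b : T) : Atom T := ⟨g.num, [t, a, b]⟩

lemma conf_map {T U : Type} (f : T → U) (q : St) (r : Fin 7 → T) :
    (conf q r).map f = conf q (fun i => f (r i)) := by
  simp [conf, Atom.map]

lemma dat_map {T U : Type} (f : T → U) (g : Tag) (t a b : T) :
    (dat g t a b).map f = dat g (f t) (f a) (f b) := rfl

lemma conf_inj {T : Type} {q q' : St} {r r' : Fin 7 → T} (h : conf q r = conf q' r') :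
    q = q' ∧ r = r' := by
  simp only [conf, Atom.mk.injEq] at h
  exact ⟨St.num_inj _ _ h.1, List.ofFn_injective h.2⟩

lemma dat_inj {T : Type} {g g' : Tag} {t a b t' a' b' : T} (h : dat g t a b = dat g' t' a' b') :
    g = g' ∧ t = t' ∧ a = a' ∧ b = b' := by
  simp only [dat, Atom.mk.injEq] at h
  refine ⟨Tag.num_inj _ _ h.1, ?_⟩
  simpa using h.2

lemma conf_ne_dat {T : Type} {q : St} {r : Fin 7 → T} {g : Tag} {t a b : T}
    (h : conf q r = dat g t a b) : False := by
  have := congrArg (fun x => x.args.length) h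
  simp [conf, dat] at this

def mk (body extra : List (Atom ℕ)) (hb : body ≠ []) : TGD :=
  ⟨body, body ++ extra, hb, by simp [hb]⟩

lemma mem_foldr (l : List (Atom ℕ)) (x : ℕ) :
    x ∈ l.foldr (fun a s => atomVars a ∪ s) ∅ ↔ ∃ a ∈ l, x ∈ a.args := by
  induction l with
  | nil => simp
  | cons a l ih => 
    rw [List.foldr_cons, Finset.mem_union, ih]
    simp [atomVars]

lemma mk_frontier (body extra hb) (x : ℕ) :
    x ∈ (mk body extra hb).frontier ↔ ∃ a ∈ body, x ∈ a.args := by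
  simp only [TGD.frontier, TGD.bodyVars, TGD.headVars, Finset.mem_inter, mem_foldr, mk,
    List.mem_append]
  constructor
  · exact fun h => h.1
  · rintro ⟨a, ha, hx⟩
    exact ⟨⟨a, ha, hx⟩, a, Or.inl ha, hx⟩

def vars : Fin 7 → ℕ := fun i => i.val

lemma mem_conf_vars (q : St) (x : ℕ) : x ∈ (conf q vars).args ↔ x < 7 := by
  simp only [conf, List.mem_ofFn, vars]
  constructor
  · rintro ⟨i, rfl⟩; exact i.2
  · intro h; exact ⟨⟨x, h⟩, rfl⟩

def pushT (q : St) (g : Tag) (i j : Fin 7) (q' : St) (ρ : Fin 7 → Fin 9) : TGD :=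
  mk [conf q vars] [dat g 7 i.val j.val, conf q' (fun t => (ρ t).val)] (by simp)
def mtchT (q : St) (g : Tag) (i : Fin 7) (q' : St) (ρ : Fin 7 → Fin 9) : TGD :=
  mk [conf q vars, dat g i.val 7 8] [conf q' (fun t => (ρ t).val)] (by simp)

lemma pushT_frontier (q g i j q' ρ) (x : ℕ) : x ∈ (pushT q g i j q' ρ).frontier ↔ x < 7 := by
  simp [pushT, mk_frontier, mem_conf_vars]

lemma mtchT_frontier (q g i q' ρ) (x : ℕ) : x ∈ (mtchT q g i q' ρ).frontier ↔ x < 9 := by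
  have := i.2
  simp only [mtchT, mk_frontier, List.mem_cons, List.not_mem_nil, or_false, exists_eq_or_imp,
    mem_conf_vars, exists_eq_left, dat]
  omega

lemma pushT_inj {q g i j q' ρ p k a b p' τ} (h : pushT q g i j q' ρ = pushT p k a b p' τ) :
    q = p := by
  have := congrArg TGD.body h
  simp only [pushT, mk, List.cons.injEq, and_true] at this
  exact (conf_inj this).1

/-- the rules -/
def Rules : Set TGD :=
  {σ | (∃ q g i j q' ρ, prog q = .push g i j q' ρ ∧ σ = pushT q g i j q' ρ) ∨
    ∃ q i f g q' ρ, prog q = .mtch i f ∧ f g = some (q', ρ) ∧ σ = mtchT q g i q' ρ}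

def ruleOf (p : St × Tag) : TGD :=
  match prog p.1 with
  | .push g i j q' ρ => pushT p.1 g i j q' ρ
  | .mtch i f => match f p.2 with
    | some (q', ρ) => mtchT p.1 p.2 i q' ρ
    | none => mk [conf p.1 vars] [] (by simp)

lemma Rules_finite : Rules.Finite := by
  refine (Set.finite_range ruleOf).subset ?_
  rintro σ (⟨q, g, i, j, q', ρ, h, rfl⟩ | ⟨q, i, f, g, q', ρ, h, h', rfl⟩)
  · exact ⟨(q, g), by simp [ruleOf, h]⟩
  · exact ⟨(q, g), by simp [ruleOf, h, h']⟩

abbrev Cf := St × (Fin 7 → TermT)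

def ext0 (r : Fin 7 → TermT) : ℕ → TermT := fun x => if h : x < 7 then r ⟨x, h⟩ else .const 0

def envP (σ : TGD) (r : Fin 7 → TermT) : ℕ → TermT :=
  fun x => if h : x < 7 then r ⟨x, h⟩ else .null σ (ext0 r) x

def envM (r : Fin 7 → TermT) (a b : TermT) : ℕ → TermT :=
  fun x => if h : x < 7 then r ⟨x, h⟩ else if x = 7 then a else b

def Dat (D : Database) (g : Tag) (t a b : TermT) : Prop := InChase D Rules (dat g t a b)

inductive CS (D : Database) : Cf → Cf → Prop
  | push {q r g i j q' ρ} (h : prog q = .push g i j q' ρ) :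
      CS D (q, r) (q', fun t => envP (pushT q g i j q' ρ) r (ρ t))
  | mtch {q r i f g a b q' ρ} (h : prog q = .mtch i f) (h' : f g = some (q', ρ))
      (hd : Dat D g (r i) a b) :
      CS D (q, r) (q', fun t => envM r a b (ρ t))

lemma push_mu (q g i j q' ρ) (h : ℕ → TermT) :
    (pushT q g i j q' ρ).mu h = envP (pushT q g i j q' ρ) (fun i => h i.val) := by
  funext x
  have e : (pushT q g i j q' ρ).restrict h = ext0 (fun i => h i.val) := by
    funext y
    simp [TGD.restrict, pushT_frontier, ext0]
  by_cases hx : x < 7 <;> simp [TGD.mu, pushT_frontier, envP, e, hx]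

lemma mtch_mu (q g i q' ρ) (h : ℕ → TermT) {x : ℕ} (hx : x < 9) :
    (mtchT q g i q' ρ).mu h x = h x := by
  simp [TGD.mu, mtchT_frontier, hx]

structure DBok (D : Database) (q0 : St) (c0 : Fin 7 → ℕ) : Prop where
  init : conf q0 c0 ∈ D
  shape : ∀ a ∈ D, a = conf q0 c0 ∨ ∃ g t x y, a = dat g t x y
  func : ∀ g t x y g' x' y', dat g t x y ∈ D → dat g' t x' y' ∈ D → g = g' ∧ x = x' ∧ y = y'

def ini (q0 : St) (c0 : Fin 7 → ℕ) : Cf := (q0, fun i => .const (c0 i))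

def CReach (D : Database) (q0 : St) (c0 : Fin 7 → ℕ) (x : Cf) : Prop := Relation.ReflTransGen (CS D) (ini q0 c0) x

def Good (D : Database) (q0 : St) (c0 : Fin 7 → ℕ) (a : Atom TermT) : Prop :=
  (∃ g t x y, dat g t x y ∈ D ∧ a = dat g (.const t) (.const x) (.const y)) ∨
  (∃ x : Cf, CReach D q0 c0 x ∧ a = conf x.1 x.2) ∨
  (∃ q r g i j q' ρ, CReach D q0 c0 (q, r) ∧ prog q = .push g i j q' ρ ∧
    a = dat g (.null (pushT q g i j q' ρ) (ext0 r) 7) (r i) (r j))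

lemma Good.conf {D q0 c0 q r} (h : Good D q0 c0 (conf q r)) : CReach D q0 c0 (q, r) := by
  rcases h with ⟨g, t, x, y, _, h⟩ | ⟨x, hx, h⟩ | ⟨_, _, _, _, _, _, _, _, _, h⟩
  · exact (conf_ne_dat h).elim
  · obtain ⟨rfl, rfl⟩ := conf_inj h; exact hx
  · exact (conf_ne_dat h).elim

lemma envP_lt (σ r) (i : Fin 7) : envP σ r i.val = r i := by simp [envP]
lemma ext0_lt (r) (i : Fin 7) : ext0 r i.val = r i := by simp [ext0]

lemma good_of_chase {D q0 c0} (ok : DBok D q0 c0) {a : Atom TermT} (h : InChase D Rules a) :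
    Good D q0 c0 a := by
  induction h with
  | @db a ha =>
    rcases ok.shape a ha with rfl | ⟨g, t, x, y, rfl⟩
    · right; left
      exact ⟨ini q0 c0, Relation.ReflTransGen.refl, by rw [conf_map]; rfl⟩
    · left; exact ⟨g, t, x, y, ha, rfl⟩
  | @step σ hσ h hb a ha ih =>
    obtain ⟨b, hbm, rfl⟩ := ha
    rcases hσ with ⟨q, g, i, j, q', ρ, hp, rfl⟩ | ⟨q, i, f, g, q', ρ, hp, hf, rfl⟩
    · have hr : CReach D q0 c0 (q, fun i => h i.val) := by
        have := ih (conf q vars) (by simp [pushT, mk])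
        rw [conf_map] at this
        exact this.conf
      rw [push_mu]
      simp only [pushT, mk, List.mem_append, List.mem_cons, List.not_mem_nil, or_false] at hbm
      rcases hbm with rfl | rfl | rfl
      · right; left
        refine ⟨_, hr, ?_⟩
        rw [conf_map]; simp only [vars, envP_lt]
      · right; right
        refine ⟨q, _, g, i, j, q', ρ, hr, hp, ?_⟩
        rw [dat_map, envP_lt, envP_lt]
        simp [envP]
      · right; left
        refine ⟨_, hr.tail (CS.push hp), ?_⟩
        rw [conf_map]
    · have hr : CReach D q0 c0 (q, fun i => h i.val) := by
        have := ih (conf q vars) (by simp [mtchT, mk])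
        rw [conf_map] at this
        exact this.conf
      have hd0 := hb (dat g i.val 7 8) (by simp [mtchT, mk])
      have hd1 := ih (dat g i.val 7 8) (by simp [mtchT, mk])
      have hi := i.2
      simp only [mtchT, mk, List.mem_append, List.mem_cons, List.not_mem_nil, or_false] at hbm
      rcases hbm with (rfl | rfl) | rfl
      · right; left
        refine ⟨_, hr, ?_⟩
        rw [conf_map]
        refine congrArg (conf _) (funext fun t => ?_)
        exact mtch_mu _ _ _ _ _ _ (by have := t.2; simp only [vars]; omega)
      · rw [dat_map, mtch_mu _ _ _ _ _ _ (by omega), mtch_mu _ _ _ _ _ _ (by omega),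
          mtch_mu _ _ _ _ _ _ (by omega)]
        exact hd1
      · right; left
        refine ⟨_, hr.tail (CS.mtch hp hf hd0), ?_⟩
        rw [conf_map]
        refine congrArg (conf _) (funext fun t => ?_)
        rw [mtch_mu _ _ _ _ _ _ (ρ t).2]
        have := (ρ t).2
        simp only [envM]
        split_ifs with h1 h2
        · rfl
        · rw [h2]
        · congr 1; omega

lemma Dat.func {D q0 c0} (ok : DBok D q0 c0) {g t a b g' a' b'} (h : Dat D g t a b)
    (h' : Dat D g' t a' b') : g = g' ∧ a = a' ∧ b = b' := by
  have H := good_of_chase ok h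
  have H' := good_of_chase ok h'
  rcases H with ⟨g1, t1, x1, y1, h1, e1⟩ | ⟨x, hx, e1⟩ | ⟨q, r, g1, i, j, q', ρ, hr, hp, e1⟩
  · obtain ⟨rfl, rfl, rfl, rfl⟩ := dat_inj e1
    rcases H' with ⟨g2, t2, x2, y2, h2, e2⟩ | ⟨x, hx, e2⟩ | ⟨q, r, g1, i, j, q', ρ, hr, hp, e2⟩
    · obtain ⟨rfl, ht, rfl, rfl⟩ := dat_inj e2
      cases ht
      obtain ⟨rfl, rfl, rfl⟩ := ok.func _ _ _ _ _ _ _ h1 h2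
      exact ⟨rfl, rfl, rfl⟩
    · exact (conf_ne_dat e2.symm).elim
    · have := (dat_inj e2).2.1
      cases this
  · exact (conf_ne_dat e1.symm).elim
  · obtain ⟨rfl, rfl, rfl, rfl⟩ := dat_inj e1
    rcases H' with ⟨g2, t2, x2, y2, h2, e2⟩ | ⟨x, hx, e2⟩ | ⟨p, s, g2, k, l, p', τ, hs, hp', e2⟩
    · have := (dat_inj e2).2.1
      cases this
    · exact (conf_ne_dat e2.symm).elim
    · obtain ⟨rfl, ht, rfl, rfl⟩ := dat_inj e2
      have e3 : pushT q g i j q' ρ = pushT p g' k l p' τ := by injection ht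
      have e4 : ext0 r = ext0 s := by injection ht
      have e5 : r = s := by
        funext t; rw [← ext0_lt r, ← ext0_lt s, e4]
      have := pushT_inj e3
      subst this e5
      rw [hp] at hp'
      injection hp' with a1 a2 a3
      subst a1 a2 a3
      exact ⟨rfl, rfl, rfl⟩

lemma CS.det {D q0 c0} (ok : DBok D q0 c0) {x y y' : Cf} (h : CS D x y) (h' : CS D x y') :
    y = y' := by
  cases h with
  | push hp =>
    cases h' with
    | push hp' =>
      rw [hp] at hp'
      injection hp' with a1 a2 a3 a4 a5
      subst a1 a2 a3 a4 a5
      rfl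
    | mtch hp' => rw [hp] at hp'; cases hp'
  | mtch hp hf hd =>
    cases h' with
    | push hp' => rw [hp] at hp'; cases hp'
    | mtch hp' hf' hd' =>
      rw [hp] at hp'
      injection hp' with a1 a2
      subst a1 a2
      obtain ⟨rfl, rfl, rfl⟩ := hd.func ok hd'
      rw [hf] at hf'
      cases hf'
      rfl

lemma chase_of_reach {D q0 c0} (ok : DBok D q0 c0) {x : Cf} (h : CReach D q0 c0 x) :
    InChase D Rules (conf x.1 x.2) := by
  induction h with
  | refl =>
    have := InChase.db (S := Rules) ok.init
    rwa [conf_map] at this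
  | @tail x y _ hs ih =>
    cases hs with
    | @push q r g i j q' ρ hp =>
      refine InChase.step (Or.inl ⟨q, g, i, j, q', ρ, hp, rfl⟩) (ext0 r) ?_
        ⟨conf q' (fun t => (ρ t).val), by simp [pushT, mk], ?_⟩
      · intro b hb
        simp only [pushT, mk, List.mem_cons, List.not_mem_nil, or_false] at hb
        subst hb
        rw [conf_map]; simpa only [vars, ext0_lt] using ih
      · rw [push_mu, conf_map]; simp only [ext0_lt]
    | @mtch q r i f g a b q' ρ hp hf hd =>
      refine InChase.step (Or.inr ⟨q, i, f, g, q', ρ, hp, hf, rfl⟩) (envM r a b) ?_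
        ⟨conf q' (fun t => (ρ t).val), by simp [mtchT, mk], ?_⟩
      · intro c hc
        simp only [mtchT, mk, List.mem_cons, List.not_mem_nil, or_false] at hc
        rcases hc with rfl | rfl
        · rw [conf_map]; simpa [vars, envM] using ih
        · rw [dat_map]; simpa [envM, Dat] using hd
      · rw [conf_map]
        refine congrArg (conf _) (funext fun t => ?_)
        exact (mtch_mu q g i q' ρ (envM r a b) (ρ t).2).symm

lemma dat_of_reach {D q0 c0} (ok : DBok D q0 c0) {q r g i j q' ρ} (h : CReach D q0 c0 (q, r))
    (hp : prog q = .push g i j q' ρ) :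
    Dat D g (.null (pushT q g i j q' ρ) (ext0 r) 7) (r i) (r j) := by
  refine InChase.step (Or.inl ⟨q, g, i, j, q', ρ, hp, rfl⟩) (ext0 r) ?_
    ⟨dat g 7 i.val j.val, by simp [pushT, mk], ?_⟩
  · intro b hb
    simp only [pushT, mk, List.mem_cons, List.not_mem_nil, or_false] at hb
    subst hb
    rw [conf_map]; simpa only [vars, ext0_lt] using chase_of_reach ok h
  · rw [push_mu, dat_map]; simp only [ext0_lt, envP_lt]; simp [envP]

/-- push step -/
lemma step_push {D q0 c0} (ok : DBok D q0 c0) {q r g i j q' ρ} (h : CReach D q0 c0 (q, r))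
    (hp : prog q = .push g i j q' ρ) :
    ∃ t, Dat D g t (r i) (r j) ∧ ∃ u, CReach D q0 c0 (q', fun s => envM r t u (ρ s)) := by
  refine ⟨_, dat_of_reach ok h hp, .null (pushT q g i j q' ρ) (ext0 r) 8, ?_⟩
  suffices e : (fun s => envM r (.null (pushT q g i j q' ρ) (ext0 r) 7)
      (.null (pushT q g i j q' ρ) (ext0 r) 8) (ρ s)) =
      fun s => envP (pushT q g i j q' ρ) r (ρ s) by
    rw [e]; exact h.tail (CS.push hp)
  funext s
  have := (ρ s).2
  simp only [envM, envP]
  split_ifs with h1 h2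
  · rfl
  · rw [h2]
  · congr 1; omega

lemma step_mtch {D q0 c0} {q r i f g a b q' ρ} (h : CReach D q0 c0 (q, r))
    (hp : prog q = .mtch i f) (hf : f g = some (q', ρ)) (hd : Dat D g (r i) a b) :
    CReach D q0 c0 (q', fun s => envM r a b (ρ s)) :=
  h.tail (CS.mtch hp hf hd)

lemma finite_of_det {α : Type} {R : α → α → Prop} (det : ∀ x y z, R x y → R x z → y = z)
    {a b : α} (h : Relation.ReflTransGen R a b) (hb : ∀ y, ¬ R b y) :
    {x | Relation.ReflTransGen R a x}.Finite := by
  induction h using Relation.ReflTransGen.head_induction_on with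
  | refl =>
    refine (Set.finite_singleton b).subset ?_
    intro x hx
    rcases Relation.ReflTransGen.cases_head hx with h | ⟨c, h, _⟩
    · exact h.symm
    · exact (hb _ h).elim
  | @head a c hac _ ih =>
    refine (ih.insert a).subset ?_
    intro x hx
    rcases Relation.ReflTransGen.cases_head hx with h | ⟨c', h, h'⟩
    · left; exact h.symm
    · right
      rw [det _ _ _ hac h]; exact h'

def outs (x : Cf) : Atom TermT :=
  match prog x.1 with
  | .push g i j q' ρ => dat g (.null (pushT x.1 g i j q' ρ) (ext0 x.2) 7) (x.2 i) (x.2 j)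
  | .mtch _ _ => conf x.1 x.2

lemma chase_finite {D q0 c0} (ok : DBok D q0 c0) {b : Cf} (h : CReach D q0 c0 b)
    (hb : ∀ y, ¬ CS D b y) : (chase D Rules).Finite := by
  have hf := finite_of_det (R := CS D) (fun x y z => CS.det ok) h hb
  refine (((D.finite_toSet.image (Atom.map TermT.const)).union
    (hf.image (fun x => conf x.1 x.2))).union (hf.image outs)).subset ?_
  intro a ha
  rcases good_of_chase ok ha with ⟨g, t, x, y, hm, rfl⟩ | ⟨x, hx, rfl⟩ |
    ⟨q, r, g, i, j, q', ρ, hr, hp, rfl⟩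
  · left; left; exact ⟨_, hm, rfl⟩
  · left; right; exact ⟨x, hx, rfl⟩
  · right; exact ⟨(q, r), hr, by simp [outs, hp]⟩

def rg (k v z n c a b : TermT) : Fin 7 → TermT := ![k, v, z, n, c, a, b]

lemma cv {D q0 c0 q r r'} (h : CReach D q0 c0 (q, r)) (h0 : r 0 = r' 0) (h1 : r 1 = r' 1)
    (h2 : r 2 = r' 2) (h3 : r 3 = r' 3) (h4 : r 4 = r' 4) (h5 : r 5 = r' 5) (h6 : r 6 = r' 6) :
    CReach D q0 c0 (q, r') := by
  have : r = r' := by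
    funext i
    fin_cases i <;> assumption
  rw [← this]; exact h

inductive RepN (D : Database) : ℕ → TermT → Prop
  | zero {t a b} : Dat D .zero t a b → RepN D 0 t
  | succ {n t a b} : Dat D .succ t a b → RepN D n a → RepN D (n + 1) t

inductive RepL (D : Database) (nc : TermT) : List ℕ → TermT → Prop
  | nil : RepL D nc [] nc
  | cons {n l t a b} : Dat D .cons t a b → RepN D n a → RepL D nc l b → RepL D nc (n :: l) t

open Turing.ToPartrec in
def RepC (D : Database) : Code → TermT → Prop
  | .zero', t => ∃ a b, Dat D .cz t a b
  | .succ, t => ∃ a b, Dat D .cs t a b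
  | .tail, t => ∃ a b, Dat D .ct t a b
  | .cons f g, t => ∃ a b, Dat D .ccons t a b ∧ RepC D f a ∧ RepC D g b
  | .comp f g, t => ∃ a b, Dat D .ccomp t a b ∧ RepC D f a ∧ RepC D g b
  | .case f g, t => ∃ a b, Dat D .ccase t a b ∧ RepC D f a ∧ RepC D g b
  | .fix f, t => ∃ a b, Dat D .cfix t a b ∧ RepC D f a

open Turing.ToPartrec in
def RepK (D : Database) (nc : TermT) : Cont → TermT → Prop
  | .halt, t => ∃ a b, Dat D .khalt t a b
  | .cons₁ fs l k, t => ∃ c p a b, Dat D .kcons1 t c p ∧ Dat D .pair p a b ∧ RepC D fs c ∧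
      RepL D nc l a ∧ RepK D nc k b
  | .cons₂ l k, t => ∃ a b, Dat D .kcons2 t a b ∧ RepL D nc l a ∧ RepK D nc k b
  | .comp f k, t => ∃ a b, Dat D .kcomp t a b ∧ RepC D f a ∧ RepK D nc k b
  | .fix f k, t => ∃ a b, Dat D .kfix t a b ∧ RepC D f a ∧ RepK D nc k b

open Turing.ToPartrec in
def RepCfg (D : Database) (zc nc : TermT) (x : Cf) : Cfg → Prop
  | .halt l => ∃ k v c a b, x = (.Ret, rg k v zc nc c a b) ∧ RepK D nc .halt k ∧ RepL D nc l v
  | .ret κ l => ∃ k v c a b, x = (.Ret, rg k v zc nc c a b) ∧ RepK D nc κ k ∧ RepL D nc l v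

lemma RepL.split {D zc nc l v} (hz : RepN D 0 zc) (hn : Dat D .cons nc zc nc)
    (h : RepL D nc l v) : ∃ a b, Dat D .cons v a b ∧ RepN D l.headI a ∧ RepL D nc l.tail b := by
  cases h with
  | nil => exact ⟨_, _, hn, hz, .nil⟩
  | cons h1 h2 h3 => exact ⟨_, _, h1, h2, h3⟩

open Turing.ToPartrec in
lemma simN {D q0 c0} (ok : DBok D q0 c0) {zc nc} (hz : RepN D 0 zc) (hn : Dat D .cons nc zc nc)
    (C : Code) : ∀ (κ : Cont) (l : List ℕ) (k v c a b : TermT), RepC D C c → RepK D nc κ k →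
      RepL D nc l v → CReach D q0 c0 (.N, rg k v zc nc c a b) →
      ∃ y, CReach D q0 c0 y ∧ RepCfg D zc nc y (stepNormal C κ l) := by
  induction C with
  | zero' =>
    intro κ l k v c a b hC hk hv hr
    obtain ⟨x, y, hd⟩ := hC
    have r1 : CReach D q0 c0 (.Z, rg k v zc nc c a b) :=
      cv (step_mtch hr rfl rfl hd) rfl rfl rfl rfl rfl rfl rfl
    obtain ⟨t, d2, u, r2⟩ := step_push ok r1 rfl
    have r2 : CReach D q0 c0 (.Ret, rg k t zc nc c a b) := cv r2 rfl rfl rfl rfl rfl rfl rfl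
    exact ⟨_, r2, k, t, c, a, b, rfl, hk, .cons d2 hz hv⟩
  | succ =>
    intro κ l k v c a b hC hk hv hr
    obtain ⟨x, y, hd⟩ := hC
    have r1 : CReach D q0 c0 (.S0, rg k v zc nc c a b) :=
      cv (step_mtch hr rfl rfl hd) rfl rfl rfl rfl rfl rfl rfl
    obtain ⟨h, tl, dv, hh, ht⟩ := hv.split hz hn
    have r2 : CReach D q0 c0 (.S1, rg k v zc nc c h b) :=
      cv (step_mtch r1 rfl rfl dv) rfl rfl rfl rfl rfl rfl rfl
    obtain ⟨s, d3, u, r3⟩ := step_push ok r2 rfl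
    have r3 : CReach D q0 c0 (.S2, rg k v zc nc c s b) := cv r3 rfl rfl rfl rfl rfl rfl rfl
    obtain ⟨w, d4, u, r4⟩ := step_push ok r3 rfl
    have r4 : CReach D q0 c0 (.Ret, rg k w zc nc c s b) := cv r4 rfl rfl rfl rfl rfl rfl rfl
    exact ⟨_, r4, k, w, c, s, b, rfl, hk, .cons d4 (.succ d3 hh) .nil⟩
  | tail =>
    intro κ l k v c a b hC hk hv hr
    obtain ⟨x, y, hd⟩ := hC
    have r1 : CReach D q0 c0 (.T0, rg k v zc nc c a b) :=
      cv (step_mtch hr rfl rfl hd) rfl rfl rfl rfl rfl rfl rfl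
    obtain ⟨h, tl, dv, hh, ht⟩ := hv.split hz hn
    have r2 : CReach D q0 c0 (.Ret, rg k tl zc nc c a b) :=
      cv (step_mtch r1 rfl rfl dv) rfl rfl rfl rfl rfl rfl rfl
    exact ⟨_, r2, k, tl, c, a, b, rfl, hk, ht⟩
  | cons f fs ihf ihfs =>
    intro κ l k v c a b hC hk hv hr
    obtain ⟨x, y, hd, hx, hy⟩ := hC
    have r1 : CReach D q0 c0 (.A1, rg k v zc nc x y b) :=
      cv (step_mtch hr rfl rfl hd) rfl rfl rfl rfl rfl rfl rfl
    obtain ⟨p, d2, u, r2⟩ := step_push ok r1 rfl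
    have r2 : CReach D q0 c0 (.A2, rg p v zc nc x y b) := cv r2 rfl rfl rfl rfl rfl rfl rfl
    obtain ⟨w, d3, u, r3⟩ := step_push ok r2 rfl
    have r3 : CReach D q0 c0 (.N, rg w v zc nc x y b) := cv r3 rfl rfl rfl rfl rfl rfl rfl
    exact ihf _ _ _ _ _ _ _ hx ⟨_, _, _, _, d3, d2, hy, hv, hk⟩ hv r3
  | comp f g ihf ihg =>
    intro κ l k v c a b hC hk hv hr
    obtain ⟨x, y, hd, hx, hy⟩ := hC
    have r1 : CReach D q0 c0 (.B1, rg k v zc nc y x b) :=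
      cv (step_mtch hr rfl rfl hd) rfl rfl rfl rfl rfl rfl rfl
    obtain ⟨p, d2, u, r2⟩ := step_push ok r1 rfl
    have r2 : CReach D q0 c0 (.N, rg p v zc nc y x b) := cv r2 rfl rfl rfl rfl rfl rfl rfl
    exact ihg _ _ _ _ _ _ _ hy ⟨_, _, d2, hx, hk⟩ hv r2
  | case f g ihf ihg =>
    intro κ l k v c a b hC hk hv hr
    obtain ⟨x, y, hd, hx, hy⟩ := hC
    have r1 : CReach D q0 c0 (.D1, rg k v zc nc c x y) :=
      cv (step_mtch hr rfl rfl hd) rfl rfl rfl rfl rfl rfl rfl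
    obtain ⟨h, tl, dv, hh, ht⟩ := hv.split hz hn
    have r2 : CReach D q0 c0 (.D2, rg k tl zc nc h x y) :=
      cv (step_mtch r1 rfl rfl dv) rfl rfl rfl rfl rfl rfl rfl
    rw [stepNormal]
    beta_reduce
    generalize l.headI = m at hh ⊢
    cases hh with
    | zero dz =>
      have r3 : CReach D q0 c0 (.N, rg k tl zc nc x x y) :=
        cv (step_mtch r2 rfl rfl dz) rfl rfl rfl rfl rfl rfl rfl
      exact ihf _ _ _ _ _ _ _ hx hk ht r3
    | @succ m _ p p' dz hp =>
      have r3 : CReach D q0 c0 (.D3, rg k tl zc nc y p y) :=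
        cv (step_mtch r2 rfl rfl dz) rfl rfl rfl rfl rfl rfl rfl
      obtain ⟨w, d4, u, r4⟩ := step_push ok r3 rfl
      have r4 : CReach D q0 c0 (.N, rg k w zc nc y p y) := cv r4 rfl rfl rfl rfl rfl rfl rfl
      exact ihg _ _ _ _ _ _ _ hy hk (.cons d4 hp ht) r4
  | fix f ihf =>
    intro κ l k v c a b hC hk hv hr
    obtain ⟨x, y, hd, hx⟩ := hC
    have r1 : CReach D q0 c0 (.E1, rg k v zc nc x a b) :=
      cv (step_mtch hr rfl rfl hd) rfl rfl rfl rfl rfl rfl rfl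
    obtain ⟨p, d2, u, r2⟩ := step_push ok r1 rfl
    have r2 : CReach D q0 c0 (.N, rg p v zc nc x a b) := cv r2 rfl rfl rfl rfl rfl rfl rfl
    exact ihf _ _ _ _ _ _ _ hx ⟨_, _, d2, hx, hk⟩ hv r2

open Turing.ToPartrec in
lemma simR {D q0 c0} (ok : DBok D q0 c0) {zc nc} (hz : RepN D 0 zc) (hn : Dat D .cons nc zc nc)
    (κ : Cont) : ∀ (l : List ℕ) (k v c a b : TermT), RepK D nc κ k →
      RepL D nc l v → CReach D q0 c0 (.Ret, rg k v zc nc c a b) →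
      ∃ y, CReach D q0 c0 y ∧ RepCfg D zc nc y (stepRet κ l) := by
  induction κ with
  | halt =>
    intro l k v c a b hk hv hr
    exact ⟨_, hr, _, _, _, _, _, rfl, hk, hv⟩
  | cons₁ fs as κ ih =>
    intro l k v c a b hk hv hr
    obtain ⟨x, p, y, k1, d1, d2, hx, hy, hk1⟩ := hk
    have r1 : CReach D q0 c0 (.G1, rg k v zc nc x p b) :=
      cv (step_mtch hr rfl rfl d1) rfl rfl rfl rfl rfl rfl rfl
    have r2 : CReach D q0 c0 (.G2, rg k1 v zc nc x y b) :=
      cv (step_mtch r1 rfl rfl d2) rfl rfl rfl rfl rfl rfl rfl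
    obtain ⟨w, d3, u, r3⟩ := step_push ok r2 rfl
    have r3 : CReach D q0 c0 (.N, rg w y zc nc x y b) := cv r3 rfl rfl rfl rfl rfl rfl rfl
    exact simN ok hz hn fs _ _ _ _ _ _ _ hx ⟨_, _, d3, hv, hk1⟩ hy r3
  | cons₂ ns κ ih =>
    intro l k v c a b hk hv hr
    obtain ⟨y, k1, d1, hy, hk1⟩ := hk
    have r1 : CReach D q0 c0 (.H1, rg k1 v zc nc c y b) :=
      cv (step_mtch hr rfl rfl d1) rfl rfl rfl rfl rfl rfl rfl
    obtain ⟨h, tl, dv, hh, ht⟩ := hy.split hz hn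
    have r2 : CReach D q0 c0 (.H2, rg k1 v zc nc c h b) :=
      cv (step_mtch r1 rfl rfl dv) rfl rfl rfl rfl rfl rfl rfl
    obtain ⟨w, d3, u, r3⟩ := step_push ok r2 rfl
    have r3 : CReach D q0 c0 (.Ret, rg k1 w zc nc c h b) := cv r3 rfl rfl rfl rfl rfl rfl rfl
    exact ih _ _ _ _ _ _ hk1 (.cons d3 hh hv) r3
  | comp f κ ih =>
    intro l k v c a b hk hv hr
    obtain ⟨x, k1, d1, hx, hk1⟩ := hk
    have r1 : CReach D q0 c0 (.N, rg k1 v zc nc x a b) :=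
      cv (step_mtch hr rfl rfl d1) rfl rfl rfl rfl rfl rfl rfl
    exact simN ok hz hn f _ _ _ _ _ _ _ hx hk1 hv r1
  | fix f κ ih =>
    intro l k v c a b hk hv hr
    have hk' := hk
    obtain ⟨x, k1, d1, hx, hk1⟩ := hk
    have r1 : CReach D q0 c0 (.I1, rg k v zc nc x a k1) :=
      cv (step_mtch hr rfl rfl d1) rfl rfl rfl rfl rfl rfl rfl
    obtain ⟨h, tl, dv, hh, ht⟩ := hv.split hz hn
    have r2 : CReach D q0 c0 (.I2, rg k tl zc nc x h k1) :=
      cv (step_mtch r1 rfl rfl dv) rfl rfl rfl rfl rfl rfl rfl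
    rw [stepRet]
    generalize l.headI = m at hh ⊢
    cases hh with
    | zero dz =>
      have r3 : CReach D q0 c0 (.Ret, rg k1 tl zc nc x h k1) :=
        cv (step_mtch r2 rfl rfl dz) rfl rfl rfl rfl rfl rfl rfl
      rw [if_pos rfl]
      exact ih _ _ _ _ _ _ hk1 ht r3
    | @succ m _ p p' dz hp =>
      have r3 : CReach D q0 c0 (.N, rg k tl zc nc x h k1) :=
        cv (step_mtch r2 rfl rfl dz) rfl rfl rfl rfl rfl rfl rfl
      rw [if_neg (Nat.succ_ne_zero m)]
      exact simN ok hz hn f _ _ _ _ _ _ _ hx hk' ht r3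

lemma RepN.func {D q0 c0} (ok : DBok D q0 c0) {n m t} (h : RepN D n t) (h' : RepN D m t) :
    n = m := by
  induction h generalizing m with
  | zero d =>
    cases h' with
    | zero => rfl
    | succ d' => cases (d.func ok d').1
  | succ d _ ih =>
    cases h' with
    | zero d' => cases (d.func ok d').1
    | succ d' h' =>
      obtain ⟨_, rfl, rfl⟩ := d.func ok d'
      rw [ih h']

lemma RepN.le_ex {D n t} (h : RepN D n t) : ∀ j ≤ n, ∃ t, RepN D j t := by
  induction h with
  | zero d => intro j hj; obtain rfl : j = 0 := by omega
              exact ⟨_, .zero d⟩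
  | @succ n t a b d h ih =>
    intro j hj
    rcases Nat.lt_or_ge n j with h1 | h1
    · obtain rfl : j = n + 1 := by omega
      exact ⟨_, .succ d h⟩
    · exact ih j h1

lemma RepN.exDat {D n t} (h : RepN D n t) : ∃ g a b, Dat D g t a b := by
  cases h with
  | zero d => exact ⟨_, _, _, d⟩
  | succ d => exact ⟨_, _, _, d⟩

lemma RepN.big {D q0 c0} (ok : DBok D q0 c0) {n t} (h : RepN D n t) :
    (n : ℕ∞) < (chase D Rules).encard := by
  have h1 : ∀ j : Fin (n + 1), ∃ t g a b, RepN D j.val t ∧ Dat D g t a b := by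
    intro j
    obtain ⟨t, ht⟩ := h.le_ex j.val (by omega)
    obtain ⟨g, a, b, d⟩ := ht.exDat
    exact ⟨_, _, _, _, ht, d⟩
  choose t g a b ht hd using h1
  have inj : Function.Injective (fun j => dat (g j) (t j) (a j) (b j)) := by
    intro i j hij
    have e := (dat_inj hij).2.1
    have h2 := ht i
    rw [e] at h2
    exact Fin.ext (h2.func ok (ht j))
  have hs : Set.range (fun j => dat (g j) (t j) (a j) (b j)) ⊆ chase D Rules := by
    rintro _ ⟨j, rfl⟩; exact hd j
  have h3 := Set.encard_le_encard hs
  rw [← Set.image_univ, inj.encard_image, Set.encard_univ] at h3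
  simp only [ENat.card_eq_coe_fintype_card, Fintype.card_fin] at h3
  refine lt_of_lt_of_le ?_ h3
  exact_mod_cast Nat.lt_succ_self n

open Turing.ToPartrec in
theorem sim {D : Database} {c0} (ok : DBok D .N c0) {kc vc zc nc cc a b}
    (hi : (fun i => TermT.const (c0 i)) = rg kc vc zc nc cc a b)
    (hz : RepN D 0 zc) (hn : Dat D .cons nc zc nc) (hk : RepK D nc .halt kc)
    {C : Code} (hC : RepC D C cc) {l} (hv : RepL D nc l vc) {m : ℕ} (hm : [m] ∈ C.eval l) :
    InCT D Rules ∧ (m : ℕ∞) < (chase D Rules).encard := by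
  have h1 : Cfg.halt [m] ∈ StateTransition.eval step (stepNormal C Cont.halt l) := by
    rw [stepNormal_eval]
    exact Part.mem_map _ hm
  have h2 := (StateTransition.mem_eval.1 h1).1
  have h0 : CReach D .N c0 (.N, rg kc vc zc nc cc a b) := by
    rw [← hi]; exact Relation.ReflTransGen.refl
  have h3 : ∃ y, CReach D .N c0 y ∧ RepCfg D zc nc y (.halt [m]) := by
    generalize Cfg.halt [m] = w at h2
    clear h1 hm
    induction h2 with
    | refl => exact simN ok hz hn C _ _ _ _ _ _ _ hC hk hv h0
    | @tail x y _ hs ih =>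
      obtain ⟨w, hw, hr⟩ := ih
      cases x with
      | halt l => cases hs
      | ret κ l =>
        obtain ⟨k, v, c, a, b, rfl, hk, hv⟩ := hr
        have : stepRet κ l = y := by
          simpa [step] using hs
        rw [← this]
        exact simR ok hz hn κ _ _ _ _ _ _ hk hv hw
  obtain ⟨y, hy, k, v, c, a, b, rfl, ⟨x, x', hk⟩, hv⟩ := h3
  constructor
  · refine chase_finite ok hy ?_
    intro w hw
    generalize hq : (St.Ret, rg k v zc nc c a b) = z at hw
    cases hw with
    | push hp => cases hq; cases hp
    | mtch hp hf hd =>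
      cases hq
      cases hp
      obtain ⟨rfl, _, _⟩ := Dat.func ok hk hd
      cases hf
  · cases hv with
    | cons _ h _ => exact h.big ok

lemma sort_eq' {α : Type} (s : Multiset α) (r : α → α → Prop) (i1 : DecidableRel r)
    (i2 : IsTrans α r) (i3 : Std.Antisymm r) (i4 : Std.Total r) :
    (↑(s.sort r) : Multiset α) = s ∧ (s.sort r).Pairwise r :=
  ⟨Multiset.sort_eq _ _, Multiset.pairwise_sort _ _⟩

open Encodable in
lemma enc_fin {α : Type} [Encodable α] (D : Finset α) : ∃ l : List α, (l : Multiset α) = D.val ∧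
    l.Pairwise (fun a b => encode a ≤ encode b) ∧ encode D = encode l := by
  refine ⟨_, ?_, ?_, rfl⟩
  · exact (sort_eq' _ _ _ _ _ _).1
  · exact List.Pairwise.imp (fun h => h) (sort_eq' _ _ _ _ _ _).2

open Encodable in
lemma enc_fin' {α : Type} [Encodable α] [DecidableEq α] (l : List α)
    (hl : l.Pairwise (fun a b => encode a < encode b)) : encode l.toFinset = encode l := by
  obtain ⟨l', h1, h2, h3⟩ := enc_fin l.toFinset
  rw [h3]
  congr 1
  have hnd : l.Nodup := hl.imp (fun h e => by subst e; exact lt_irrefl _ h)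
  have hp : l'.Perm l := by
    rw [List.toFinset_val, hnd.dedup] at h1
    exact Multiset.coe_eq_coe.1 h1
  exact List.Perm.eq_of_pairwise (fun a b _ _ h h' => encode_injective (le_antisymm h h')) h2
    (hl.imp le_of_lt) hp

open Encodable in
lemma enc_list {α : Type} [Encodable α] (l : List α) : encode l = encode (l.map encode) := by
  induction l with
  | nil => rfl
  | cons a l ih => rw [List.map_cons, encode_list_cons, encode_list_cons, ih]; rfl

open Turing.ToPartrec

def encC : Code → ℕ
  | .zero' => Nat.pair 0 0
  | .succ => Nat.pair 1 0
  | .tail => Nat.pair 2 0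
  | .cons f g => Nat.pair 3 (Nat.pair (encC f) (encC g))
  | .comp f g => Nat.pair 4 (Nat.pair (encC f) (encC g))
  | .case f g => Nat.pair 5 (Nat.pair (encC f) (encC g))
  | .fix f => Nat.pair 6 (encC f)

lemma encC_inj : Function.Injective encC := by
  intro a
  induction a with
  | zero' => intro b h; cases b <;> simp_all [encC, Nat.pair_eq_pair]
  | succ => intro b h; cases b <;> simp_all [encC, Nat.pair_eq_pair]
  | tail => intro b h; cases b <;> simp_all [encC, Nat.pair_eq_pair]
  | cons f g i1 i2 =>
    intro b h; cases b <;> simp [encC, Nat.pair_eq_pair] at h; rw [i1 h.1, i2 h.2]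
  | comp f g i1 i2 =>
    intro b h; cases b <;> simp [encC, Nat.pair_eq_pair] at h; rw [i1 h.1, i2 h.2]
  | case f g i1 i2 =>
    intro b h; cases b <;> simp [encC, Nat.pair_eq_pair] at h; rw [i1 h.1, i2 h.2]
  | fix f i1 => intro b h; cases b <;> simp [encC, Nat.pair_eq_pair] at h; rw [i1 h]

def node (c : Code) : ℕ := 5 + encC c

lemma node_inj : Function.Injective node := fun a b h => encC_inj (by simpa [node] using h)

def cinfo : Code → Tag × ℕ × ℕ
  | .zero' => (.cz, 0, 0)
  | .succ => (.cs, 0, 0)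
  | .tail => (.ct, 0, 0)
  | .cons f g => (.ccons, node f, node g)
  | .comp f g => (.ccomp, node f, node g)
  | .case f g => (.ccase, node f, node g)
  | .fix f => (.cfix, node f, node f)

def catom (c : Code) : Atom ℕ := dat (cinfo c).1 (node c) (cinfo c).2.1 (cinfo c).2.2

def catoms : Code → List (Atom ℕ)
  | .cons f g => catom (.cons f g) :: (catoms f ++ catoms g)
  | .comp f g => catom (.comp f g) :: (catoms f ++ catoms g)
  | .case f g => catom (.case f g) :: (catoms f ++ catoms g)
  | .fix f => catom (.fix f) :: catoms f
  | c => [catom c]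

lemma catoms_mem (c : Code) : ∀ a ∈ catoms c, ∃ c', a = catom c' := by
  induction c with
  | zero' => intro a h; simp only [catoms, List.mem_singleton] at h; exact ⟨_, h⟩
  | succ => intro a h; simp only [catoms, List.mem_singleton] at h; exact ⟨_, h⟩
  | tail => intro a h; simp only [catoms, List.mem_singleton] at h; exact ⟨_, h⟩
  | cons f g i1 i2 =>
    intro a h; simp only [catoms, List.mem_cons, List.mem_append] at h
    rcases h with h | h | h
    exacts [⟨_, h⟩, i1 a h, i2 a h]
  | comp f g i1 i2 =>
    intro a h; simp only [catoms, List.mem_cons, List.mem_append] at h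
    rcases h with h | h | h
    exacts [⟨_, h⟩, i1 a h, i2 a h]
  | case f g i1 i2 =>
    intro a h; simp only [catoms, List.mem_cons, List.mem_append] at h
    rcases h with h | h | h
    exacts [⟨_, h⟩, i1 a h, i2 a h]
  | fix f i1 =>
    intro a h; simp only [catoms, List.mem_cons] at h
    rcases h with h | h
    exacts [⟨_, h⟩, i1 a h]

lemma dat_db {D : Database} {g t x y} (h : dat g t x y ∈ D) :
    Dat D g (.const t) (.const x) (.const y) := by
  have := InChase.db (S := Rules) h
  rwa [dat_map] at this

lemma repC_of {D : Database} (c : Code) (h : ∀ a ∈ catoms c, a ∈ D) :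
    RepC D c (.const (node c)) := by
  induction c with
  | zero' => exact ⟨_, _, dat_db (h _ (List.mem_singleton.2 rfl))⟩
  | succ => exact ⟨_, _, dat_db (h _ (List.mem_singleton.2 rfl))⟩
  | tail => exact ⟨_, _, dat_db (h _ (List.mem_singleton.2 rfl))⟩
  | cons f g i1 i2 =>
    simp only [catoms, List.mem_cons, List.mem_append] at h
    exact ⟨_, _, dat_db (h _ (Or.inl rfl)), i1 fun a ha => h a (.inr (.inl ha)),
      i2 fun a ha => h a (.inr (.inr ha))⟩
  | comp f g i1 i2 =>
    simp only [catoms, List.mem_cons, List.mem_append] at h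
    exact ⟨_, _, dat_db (h _ (Or.inl rfl)), i1 fun a ha => h a (.inr (.inl ha)),
      i2 fun a ha => h a (.inr (.inr ha))⟩
  | case f g i1 i2 =>
    simp only [catoms, List.mem_cons, List.mem_append] at h
    exact ⟨_, _, dat_db (h _ (Or.inl rfl)), i1 fun a ha => h a (.inr (.inl ha)),
      i2 fun a ha => h a (.inr (.inr ha))⟩
  | fix f i1 =>
    simp only [catoms, List.mem_cons] at h
    exact ⟨_, _, dat_db (h _ (Or.inl rfl)), i1 fun a ha => h a (.inr ha)⟩

def c0 (c : Code) : Fin 7 → ℕ := ![0, 1, 2, 3, node c, 2, 2]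

def base (c : Code) : List (Atom ℕ) :=
  conf .N (c0 c) :: dat .khalt 0 0 0 :: dat .cons 1 4 3 :: dat .zero 2 2 2 :: dat .cons 3 2 3 ::
    catoms c

def ch (B i : ℕ) : ℕ := if i = 0 then 4 else B + (i - 1)

def chain (B n : ℕ) : List (Atom ℕ) :=
  (List.range n).map (fun i => dat .succ (ch B i) (ch B (i + 1)) (ch B (i + 1))) ++
    [dat .zero (ch B n) (ch B (n + 1)) (ch B (n + 1))]

open Encodable

lemma encode_dat (g : Tag) (t x y : ℕ) : encode (dat g t x y) =
    Nat.pair g.num (Nat.pair t (Nat.pair x (Nat.pair y 0 + 1) + 1) + 1) := rfl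

lemma lt_encode_dat (g : Tag) (t x y : ℕ) : t < encode (dat g t x y) ∧ x < encode (dat g t x y) := by
  rw [encode_dat]
  have h1 := Nat.right_le_pair g.num (Nat.pair t (Nat.pair x (Nat.pair y 0 + 1) + 1) + 1)
  have h2 := Nat.right_le_pair t (Nat.pair x (Nat.pair y 0 + 1) + 1)
  have h3 := Nat.left_le_pair t (Nat.pair x (Nat.pair y 0 + 1) + 1)
  have h4 := Nat.left_le_pair x (Nat.pair y 0 + 1)
  omega

lemma pair_mono {a b c d : ℕ} (h : a ≤ c) (h' : b ≤ d) : Nat.pair a b ≤ Nat.pair c d := by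
  refine le_trans (b := Nat.pair c b) ?_ ?_
  · rcases h.lt_or_eq with h | rfl
    · exact (Nat.pair_lt_pair_left _ h).le
    · exact le_rfl
  · rcases h'.lt_or_eq with h | rfl
    · exact (Nat.pair_lt_pair_right _ h).le
    · exact le_rfl

lemma encode_dat_lt {g g' : Tag} {t x y t' x' y' : ℕ} (hg : g.num ≤ g'.num) (ht : t < t')
    (hx : x ≤ x') (hy : y ≤ y') : encode (dat g t x y) < encode (dat g' t' x' y') := by
  rw [encode_dat, encode_dat]
  refine lt_of_le_of_lt (pair_mono hg le_rfl) (Nat.pair_lt_pair_right _ ?_)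
  refine Nat.succ_lt_succ (lt_of_lt_of_le (Nat.pair_lt_pair_left _ ht) (pair_mono le_rfl ?_))
  exact Nat.succ_le_succ (pair_mono hx (Nat.succ_le_succ (pair_mono hy le_rfl)))

lemma ch_lt {B i j : ℕ} (hB : 5 < B) (h : i < j) : ch B i < ch B j := by
  unfold ch; split_ifs <;> omega

lemma chain_pw {B : ℕ} (hB : 5 < B) (n : ℕ) :
    (chain B n).Pairwise (fun a b => encode a < encode b) := by
  unfold chain
  rw [List.pairwise_append]
  refine ⟨?_, List.pairwise_singleton _ _, ?_⟩
  · rw [List.pairwise_map]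
    refine List.pairwise_lt_range.imp ?_
    intro i j h
    exact encode_dat_lt le_rfl (ch_lt hB h) (ch_lt hB (by omega)).le (ch_lt hB (by omega)).le
  · intro a ha b hb
    obtain ⟨i, hi, rfl⟩ := List.mem_map.1 ha
    rw [List.mem_singleton] at hb
    subst hb
    rw [List.mem_range] at hi
    exact encode_dat_lt (by decide) (ch_lt hB hi) (ch_lt hB (by omega)).le (ch_lt hB (by omega)).le

lemma chain_big {B : ℕ} (n : ℕ) : ∀ a ∈ chain B n, B < encode a := by
  have key : ∀ i, B ≤ ch B (i + 1) := by intro i; simp [ch]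
  intro a ha
  unfold chain at ha
  rcases List.mem_append.1 ha with ha | ha
  · obtain ⟨i, hi, rfl⟩ := List.mem_map.1 ha
    exact lt_of_le_of_lt (key i) (lt_encode_dat _ _ _ _).2
  · rw [List.mem_singleton] at ha
    subst ha
    exact lt_of_le_of_lt (key n) (lt_encode_dat _ _ _ _).2

lemma prim_ch (B : ℕ) : Primrec (ch B) := by
  unfold ch
  exact Primrec.ite (Primrec.eq.comp Primrec.id (Primrec.const 0)) (Primrec.const 4)
    (Primrec.nat_add.comp (Primrec.const B) (Primrec.nat_sub.comp Primrec.id (Primrec.const 1)))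

lemma prim_dat (g : Tag) {t x y : ℕ → ℕ} (ht : Primrec t) (hx : Primrec x) (hy : Primrec y) :
    Primrec (fun n => encode (dat g (t n) (x n) (y n))) := by
  simp only [encode_dat]
  have p : ∀ {f g : ℕ → ℕ}, Primrec f → Primrec g → Primrec (fun n => Nat.pair (f n) (g n)) :=
    fun hf hg => Primrec₂.natPair.comp hf hg
  exact p (Primrec.const _) (Primrec.succ.comp (p ht (Primrec.succ.comp (p hx
    (Primrec.succ.comp (p hy (Primrec.const 0)))))))

lemma prim_chain (B : ℕ) : Primrec (fun n => (chain B n).map encode) := by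
  have hs : Primrec (fun n => ch B (n + 1)) := (prim_ch B).comp Primrec.succ
  simp only [chain, List.map_append, List.map_map, List.map_cons, List.map_nil]
  refine Primrec.list_append.comp (Primrec.list_map Primrec.list_range ?_) ?_
  · exact ((prim_dat .succ (prim_ch B) hs hs).comp Primrec.snd).to₂
  · exact Primrec.list_cons.comp (prim_dat .zero (prim_ch B) hs hs) (Primrec.const [])

lemma exists_bound (l : List (Atom ℕ)) : ∃ B, 5 < B ∧ ∀ a ∈ l, encode a < B := by
  induction l with
  | nil => exact ⟨6, by omega, by simp⟩
  | cons a l ih =>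
    obtain ⟨B, h, hB⟩ := ih
    refine ⟨B + encode a + 1, by omega, ?_⟩
    intro b hb
    rcases List.mem_cons.1 hb with rfl | hb
    · omega
    · have := hB b hb; omega

def db (c : Code) (B n : ℕ) : Database := (base c ++ chain B n).toFinset

lemma comp_db (c : Code) (B : ℕ) (h5 : 5 < B) (hB : ∀ a ∈ base c, encode a < B) :
    Primrec (fun n => encode (db c B n)) := by
  obtain ⟨l, h1, h2, -⟩ := enc_fin (base c).toFinset
  have hnd : l.Nodup := by
    rw [← Multiset.coe_nodup, h1]; exact Finset.nodup _
  have hm : ∀ a, a ∈ l ↔ a ∈ base c := by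
    intro a
    rw [← Multiset.mem_coe, h1, Finset.mem_val, List.mem_toFinset]
  have hl : l.Pairwise (fun a b => encode a < encode b) := by
    refine (h2.and hnd).imp ?_
    rintro a b ⟨h, h'⟩
    exact lt_of_le_of_ne h (fun e => h' (encode_injective e))
  have e : ∀ n, encode (db c B n) = encode (l.map encode ++ (chain B n).map encode) := by
    intro n
    rw [← List.map_append, ← enc_list, ← enc_fin']
    · congr 1
      ext a
      simp [db, hm]
    · rw [List.pairwise_append]
      refine ⟨hl, chain_pw h5 n, ?_⟩
      intro a ha b hb
      exact ((hB a ((hm a).1 ha)).trans (chain_big n b hb))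
  simp only [e]
  exact Primrec.encode.comp (Primrec.list_append.comp (Primrec.const _) (prim_chain B))

def chinfo (B n i : ℕ) : Tag × ℕ × ℕ :=
  (if i < n then .succ else .zero, ch B (i + 1), ch B (i + 1))

noncomputable def info (B n t : ℕ) : Tag × ℕ × ℕ :=
  if t = 0 then (.khalt, 0, 0) else if t = 1 then (.cons, 4, 3) else
  if t = 2 then (.zero, 2, 2) else if t = 3 then (.cons, 2, 3) else
  if t = 4 then chinfo B n 0 else if t < B then cinfo (Function.invFun node t) else
  chinfo B n (t - B + 1)

lemma info_ch {B n i : ℕ} (h5 : 5 < B) : info B n (ch B i) = chinfo B n i := by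
  unfold ch
  split_ifs with h
  · subst h; simp [info]
  · unfold info
    rw [if_neg (by omega), if_neg (by omega), if_neg (by omega), if_neg (by omega),
      if_neg (by omega), if_neg (by omega)]
    congr 1; omega

lemma info_dat {c : Code} {B n : ℕ} (h5 : 5 < B) (hB : ∀ a ∈ base c, encode a < B) :
    ∀ a ∈ db c B n, a = conf .N (c0 c) ∨
      ∃ g t x y, a = dat g t x y ∧ info B n t = (g, x, y) := by
  intro a ha
  rw [db, List.mem_toFinset, List.mem_append] at ha
  rcases ha with ha | ha
  · have hb := hB a ha
    simp only [base, List.mem_cons] at ha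
    rcases ha with rfl | rfl | rfl | rfl | rfl | ha
    · exact .inl rfl
    · exact .inr ⟨_, _, _, _, rfl, by simp [info]⟩
    · exact .inr ⟨_, _, _, _, rfl, by simp [info]⟩
    · exact .inr ⟨_, _, _, _, rfl, by simp [info]⟩
    · exact .inr ⟨_, _, _, _, rfl, by simp [info]⟩
    · obtain ⟨c', rfl⟩ := catoms_mem c a ha
      have h1 : node c' < B := (lt_encode_dat _ _ _ _).1.trans hb
      have h2 : 5 ≤ node c' := by simp [node]
      refine .inr ⟨_, _, _, _, rfl, ?_⟩
      unfold info
      rw [if_neg (by omega), if_neg (by omega), if_neg (by omega), if_neg (by omega),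
        if_neg (by omega), if_pos h1, Function.leftInverse_invFun node_inj]
  · right
    unfold chain at ha
    rcases List.mem_append.1 ha with ha | ha
    · obtain ⟨i, hi, rfl⟩ := List.mem_map.1 ha
      refine ⟨_, _, _, _, rfl, ?_⟩
      rw [info_ch h5, chinfo, if_pos (List.mem_range.1 hi)]
    · rw [List.mem_singleton] at ha
      subst ha
      refine ⟨_, _, _, _, rfl, ?_⟩
      rw [info_ch h5, chinfo, if_neg (lt_irrefl _)]

lemma db_ok {c : Code} {B n : ℕ} (h5 : 5 < B) (hB : ∀ a ∈ base c, encode a < B) :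
    DBok (db c B n) .N (c0 c) where
  init := by simp [db, base]
  shape a ha := by
    rcases info_dat h5 hB a ha with h | ⟨g, t, x, y, h, _⟩
    exacts [.inl h, .inr ⟨g, t, x, y, h⟩]
  func := by
    have key : ∀ g t x y, dat g t x y ∈ db c B n → info B n t = (g, x, y) := by
      intro g t x y h
      rcases info_dat h5 hB _ h with h | ⟨g', t', x', y', h, h'⟩
      · exact (conf_ne_dat h.symm).elim
      · obtain ⟨rfl, rfl, rfl, rfl⟩ := dat_inj h
        exact h'
    intro g t x y g' x' y' h h'
    have := (key _ _ _ _ h).symm.trans (key _ _ _ _ h')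
    simpa using this

lemma repN_chain {D : Database} {B n : ℕ} (h : ∀ a ∈ chain B n, a ∈ D) :
    ∀ k i, i + k = n → RepN D k (.const (ch B i)) := by
  intro k
  induction k with
  | zero =>
    intro i hi
    obtain rfl : i = n := by omega
    exact .zero (dat_db (h _ (List.mem_append_right _ (List.mem_singleton.2 rfl))))
  | succ k ih =>
    intro i hi
    refine .succ (dat_db (h (dat .succ (ch B i) (ch B (i + 1)) (ch B (i + 1)))
      (List.mem_append_left _ (List.mem_map.2 ⟨i, List.mem_range.2 (by omega), rfl⟩))))
      (ih (i + 1) (by omega))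

lemma db_sim {c : Code} {B n m : ℕ} (h5 : 5 < B) (hB : ∀ a ∈ base c, encode a < B)
    (hm : [m] ∈ c.eval [n]) :
    InCT (db c B n) Rules ∧ (m : ℕ∞) < (chase (db c B n) Rules).encard := by
  have hb : ∀ a ∈ base c, a ∈ db c B n := by intro a ha; simp [db, ha]
  have hc : ∀ a ∈ chain B n, a ∈ db c B n := by intro a ha; simp [db, ha]
  refine sim (db_ok h5 hB) (kc := .const 0) (vc := .const 1) (zc := .const 2) (nc := .const 3)
    (cc := .const (node c)) (a := .const 2) (b := .const 2) (C := c) (l := [n]) ?_ ?_ ?_ ?_ ?_ ?_ hm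
  · funext i; fin_cases i <;> rfl
  · exact .zero (dat_db (hb (dat .zero 2 2 2) (by simp [base])))
  · exact dat_db (hb (dat .cons 3 2 3) (by simp [base]))
  · exact ⟨_, _, dat_db (hb (dat .khalt 0 0 0) (by simp [base]))⟩
  · exact repC_of c fun a ha => hb a (by simp [base, ha])
  · exact .cons (dat_db (hb (dat .cons 1 4 3) (by simp [base]))) (repN_chain hc n 0 (by omega)) .nil

lemma univ_code : ∃ c : Code, ∀ (e : Nat.Partrec.Code), 
    c.eval [encode e] = pure <$> e.eval (encode e) := by
  have h : Partrec (fun n : ℕ => (Denumerable.ofNat Nat.Partrec.Code n).eval n) :=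
    Nat.Partrec.Code.eval_part.comp (Computable.ofNat _) Computable.id
  obtain ⟨c, hc⟩ := Code.exists_code (Nat.Partrec'.part_iff₁.2 h)
  refine ⟨c, fun e => ?_⟩
  have := hc (encode e ::ᵥ List.Vector.nil)
  rw [show (encode e ::ᵥ List.Vector.nil).1 = [encode e] from rfl] at this
  simpa using this

theorem main_aux : ∃ S : Set TGD, S.Finite ∧
      ∀ f : ℕ → ℕ, Computable f →
        ∃ D : Database, InCT D S ∧
          ((f (Encodable.encode D) : ℕ∞) < (chase D S).encard) := by
  refine ⟨Rules, Rules_finite, fun f hf => ?_⟩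
  obtain ⟨c, hc⟩ := univ_code
  obtain ⟨B, h5, hB⟩ := exists_bound (base c)
  have hg : Computable (fun n => f (encode (db c B n))) := hf.comp (comp_db c B h5 hB).to_comp
  obtain ⟨e, he⟩ := Nat.Partrec.Code.exists_code.1 (Partrec.nat_iff.1 hg)
  refine ⟨db c B (encode e), db_sim h5 hB ?_⟩
  rw [hc e, he]
  simp

end CB

/-- There exists a finite set `Σ` of TGDs such that for every computable
function `f` from (encodings of) databases to ℕ there is a database `D` with `Σ ∈ CT_D`
and `|chase(D,Σ)| > f D`. -/
theorem no_computable_chase_size_bound :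
    ∃ S : Set TGD, S.Finite ∧
      ∀ f : ℕ → ℕ, Computable f →
        ∃ D : Database, InCT D S ∧
          ((f (Encodable.encode D) : ℕ∞) < (chase D S).encard) := by
  exact CB.main_aux
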